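/- An abelian group G is artinian if and only if: G is torsion, the p-torsion subgroup {x ∈ G : p·x = 0} is finite for every prime p, and G has non-trivial p-torsion for only finitely many primes p. -/

import Mathlib

/-- An abelian group is artinian if every descending sequence of subgroups
eventually stabilizes. -/
def AddArtinian (G : Type*) [AddCommGroup G] : Prop :=
  ∀ f : ℕ → AddSubgroup G, (∀ n, f (n + 1) ≤ f n) → ∃ n, ∀ m, n ≤ m → f m = f n

/-- A doubly indexed family, antitone in each index, with values in a well-founded order
stabilizes in the first index uniformly in the second. -/
theorem exists_forall_ge_eq_of_antitone {α : Type*} [PartialOrder α] [WellFoundedLT α]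
    (a : ℕ → ℕ → α) (hn : ∀ k, Antitone fun n => a n k) (hk : ∀ n, Antitone (a n)) :
    ∃ n, ∀ m, n ≤ m → ∀ k, a m k = a n k := by
  have stab : ∀ k, ∃ n, ∀ m, n ≤ m → a n k = a m k := fun k =>
    WellFoundedGT.monotone_chain_condition (α := αᵒᵈ)
      ⟨fun n => OrderDual.toDual (a n k), hn k⟩
  choose N hN using stab
  obtain ⟨l, hl⟩ := WellFoundedGT.monotone_chain_condition (α := αᵒᵈ)
    ⟨fun n => OrderDual.toDual (a n n), fun i j hij => (hn j hij).trans (hk i hij)⟩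
  replace hl : ∀ m, l ≤ m → a l l = a m m := hl
  have large : ∀ m k, l ≤ m → l ≤ k → a m k = a l l := fun m k hm hlk =>
    le_antisymm ((hk m hlk).trans (hn l hm))
      ((hl (max m k) (hm.trans (le_max_left _ _))).le.trans
        ((hk _ (le_max_right m k)).trans (hn k (le_max_left m k))))
  refine ⟨max l ((Finset.range l).sup N), fun m hm k => ?_⟩
  obtain hlk | hlk := le_or_gt l k
  · rw [large m k ((le_max_left _ _).trans hm) hlk, large _ k (le_max_left _ _) hlk]
  · have hNk : N k ≤ max l ((Finset.range l).sup N) :=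
      (Finset.le_sup (f := N) (Finset.mem_range.2 hlk)).trans (le_max_right _ _)
    rw [← hN k m (hNk.trans hm), ← hN k _ hNk]

/-- A module all of whose elements are annihilated by powers of `r` is artinian as soon as its
`r`-torsion is. -/
theorem isArtinian_of_isArtinian_torsionBy {R M : Type*} [CommRing R] [AddCommGroup M]
    [Module R M] (r : R) (hr : ∀ x : M, ∃ k : ℕ, r ^ k • x = 0)
    [IsArtinian R (Submodule.torsionBy R M r)] : IsArtinian R M := by
  let D (H : Submodule R M) (k : ℕ) : Submodule R (Submodule.torsionBy R M r) :=
    (H.map (LinearMap.lsmul R M (r ^ k))).comap (Submodule.torsionBy R M r).subtype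
  have D_mono : ∀ k, Monotone fun H => D H k := fun k _ _ h =>
    Submodule.comap_mono (Submodule.map_mono h)
  have D_anti : ∀ H, Antitone (D H) := fun H => antitone_nat_of_succ_le fun k => by
    rintro x ⟨y, hy, hyx⟩
    refine ⟨r • y, H.smul_mem r hy, ?_⟩
    rw [← hyx]
    simpa [pow_succ, mul_smul] using smul_comm r (r ^ k) y
  have le_of_D : ∀ H K : Submodule R M, K ≤ H → (∀ k, D K k = D H k) → H ≤ K := by
    intro H K hKH hD
    have key : ∀ k : ℕ, ∀ x ∈ H, r ^ k • x = 0 → x ∈ K := by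
      intro k
      induction k with
      | zero => intro x _ hx; simp_all
      | succ k ih =>
        intro x hxH hx
        have hmem : (⟨r ^ k • x, by
            rw [Submodule.mem_torsionBy_iff, ← mul_smul, ← pow_succ', hx]⟩ :
            Submodule.torsionBy R M r) ∈ D K k := by
          rw [hD k]
          exact ⟨x, hxH, rfl⟩
        obtain ⟨y, hy, hyx⟩ := hmem
        have hyx' : r ^ k • y = r ^ k • x := hyx
        have hsub := ih (x - y) (H.sub_mem hxH (hKH hy)) (by rw [smul_sub, hyx', sub_self])
        simpa using K.add_mem hsub hy
    intro x hx
    obtain ⟨k, hk⟩ := hr x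
    exact key k x hx hk
  rw [← monotone_stabilizes_iff_artinian]
  intro f
  have f_anti : Antitone fun n => OrderDual.ofDual (f n) := f.monotone
  obtain ⟨n, hn⟩ := exists_forall_ge_eq_of_antitone (fun n k => D (OrderDual.ofDual (f n)) k)
    (fun k _ _ h => D_mono k (f_anti h)) (fun n => D_anti _)
  exact ⟨n, fun m hm => le_antisymm (f.monotone hm) (le_of_D _ _ (f_anti hm) (hn m hm))⟩

theorem addArtinian_iff_isArtinian_int (G : Type*) [AddCommGroup G] :
    AddArtinian G ↔ IsArtinian ℤ G := by
  rw [← monotone_stabilizes_iff_artinian]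
  constructor
  · intro h f
    obtain ⟨n, hn⟩ := h (fun n => (OrderDual.ofDual (f n)).toAddSubgroup)
      (fun n => f.monotone n.le_succ)
    exact ⟨n, fun m hm => (Submodule.toAddSubgroup_injective (hn m hm)).symm⟩
  · intro h f hf
    obtain ⟨n, hn⟩ := h ⟨fun n => OrderDual.toDual (AddSubgroup.toIntSubmodule (f n)),
      fun i j hij => AddSubgroup.toIntSubmodule.monotone (antitone_nat_of_succ_le hf hij)⟩
    exact ⟨n, fun m hm => (AddSubgroup.toIntSubmodule.injective (hn m hm)).symm⟩

theorem Module.finite_of_isArtinian_of_divisionRing (K V : Type*) [DivisionRing K]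
    [AddCommGroup V] [Module K V] [h : IsArtinian K V] : Module.Finite K V :=
  ((IsSemisimpleModule.finite_tfae (R := K) (M := V)).out 0 2).2 h

section Int

variable {G : Type*} [AddCommGroup G]

theorem IsArtinian.exists_pos_nsmul_eq_zero [IsArtinian ℤ G] (x : G) :
    ∃ n : ℕ, 0 < n ∧ n • x = 0 := by
  obtain ⟨n, ⟨y, hy⟩, h⟩ := IsArtinian.exists_pow_succ_smul_dvd (2 : ℤ)
    (⟨x, Submodule.mem_span_singleton_self x⟩ : Submodule.span ℤ {x})
  obtain ⟨a, rfl⟩ := Submodule.mem_span_singleton.1 hy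
  have h' : (2 : ℤ) ^ (n + 1) • a • x = (2 : ℤ) ^ n • x := congrArg Subtype.val h
  have hz : ((2 : ℤ) ^ n * (2 * a - 1)) • x = 0 := by
    rw [mul_sub, sub_smul, ← mul_assoc, ← pow_succ, mul_smul, h', mul_one, sub_self]
  refine ⟨((2 : ℤ) ^ n * (2 * a - 1)).natAbs, Int.natAbs_pos.2 ?_, natAbs_nsmul_eq_zero.2 hz⟩
  exact mul_ne_zero (by positivity) (by omega)

theorem IsArtinian.finite_of_prime_nsmul_eq_zero [IsArtinian ℤ G] {p : ℕ} (hp : p.Prime)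
    (h : ∀ x : G, p • x = 0) : Finite G := by
  have : Fact p.Prime := ⟨hp⟩
  have : Module (ZMod p) G := AddCommGroup.zmodModule h
  have : IsArtinian (ZMod p) G := isArtinian_of_tower ℤ inferInstance
  have : Module.Finite (ZMod p) G := Module.finite_of_isArtinian_of_divisionRing (ZMod p) G
  exact Module.finite_of_finite (ZMod p)

theorem IsArtinian.finite_setOf_prime_nsmul_eq_zero [IsArtinian ℤ G] {p : ℕ} (hp : p.Prime) :
    {x : G | p • x = 0}.Finite := by
  have : Finite (Submodule.torsionBy ℤ G (p : ℤ)) :=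
    IsArtinian.finite_of_prime_nsmul_eq_zero hp fun x => by
      rw [← natCast_zsmul]
      exact Submodule.smul_torsionBy _ x
  refine (Set.toFinite (Submodule.torsionBy ℤ G (p : ℤ) : Set G)).subset fun x hx => ?_
  simpa using hx

/-- The elements annihilated by an integer coprime to `n`. -/
def coprimeTorsion (G : Type*) [AddCommGroup G] (n : ℕ) : AddSubgroup G where
  carrier := {x | ∃ m : ℕ, m.Coprime n ∧ m • x = 0}
  zero_mem' := ⟨1, Nat.coprime_one_left n, smul_zero 1⟩
  add_mem' := by
    rintro x y ⟨a, ha, hax⟩ ⟨b, hb, hby⟩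
    refine ⟨a * b, ha.mul_left hb, ?_⟩
    rw [smul_add, mul_smul a b y, hby, mul_comm, mul_smul, hax, smul_zero, smul_zero, add_zero]
  neg_mem' := by
    rintro x ⟨a, ha, hax⟩
    exact ⟨a, ha, by rw [smul_neg, hax, neg_zero]⟩

theorem eq_zero_of_coprime_nsmul_eq_zero {m n : ℕ} (h : m.Coprime n) {x : G}
    (hm : m • x = 0) (hn : n • x = 0) : x = 0 := by
  rw [← AddMonoid.addOrderOf_eq_one_iff]
  exact Nat.eq_one_of_dvd_coprimes h (addOrderOf_dvd_of_nsmul_eq_zero hm)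
    (addOrderOf_dvd_of_nsmul_eq_zero hn)

theorem AddArtinian.finite_setOf_prime_torsion (h : AddArtinian G) :
    {p : ℕ | p.Prime ∧ ∃ x : G, x ≠ 0 ∧ p • x = 0}.Finite := by
  obtain ⟨n, hn⟩ := h (fun n => coprimeTorsion G n.factorial) fun n x ⟨m, hm, hx⟩ =>
    ⟨m, hm.coprime_dvd_right (Nat.factorial_dvd_factorial n.le_succ), hx⟩
  refine (Set.finite_Iic n).subset fun p ⟨hp, x, hx0, hx⟩ => ?_
  by_contra hpn
  have hnp : n < p := not_le.1 hpn
  have hmem : x ∈ coprimeTorsion G n.factorial :=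
    ⟨p, hp.coprime_factorial_of_lt hnp, hx⟩
  rw [← hn p hnp.le] at hmem
  obtain ⟨m, hm, hmx⟩ := hmem
  exact hx0 (eq_zero_of_coprime_nsmul_eq_zero
    (hm.coprime_dvd_right (Nat.dvd_factorial hp.pos le_rfl)) hmx hx)

theorem finite_setOf_mul_nsmul_eq_zero {a b : ℕ} (ha : {x : G | a • x = 0}.Finite)
    (hb : {x : G | b • x = 0}.Finite) : {x : G | (a * b) • x = 0}.Finite := by
  have : {x : G | (a * b) • x = 0} = (fun x => b • x) ⁻¹' {x : G | a • x = 0} := by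
    ext x
    simp [mul_smul]
  rw [this]
  refine ha.preimage' fun y _ => ?_
  obtain hy | ⟨x, hx⟩ := ((fun x : G => b • x) ⁻¹' {y}).eq_empty_or_nonempty
  · simp [hy]
  · refine (hb.image (x + ·)).subset fun z hz => ⟨z - x, ?_, add_sub_cancel x z⟩
    simp_all [smul_sub]

theorem finite_setOf_prod_nsmul_eq_zero (s : Finset ℕ)
    (h : ∀ p ∈ s, {x : G | p • x = 0}.Finite) : {x : G | (∏ p ∈ s, p) • x = 0}.Finite := by
  induction s using Finset.induction_on with
  | empty => simp
  | insert p s hp ih =>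
    rw [Finset.prod_insert hp]
    exact finite_setOf_mul_nsmul_eq_zero (h p (by simp))
      (ih fun q hq => h q (Finset.mem_insert_of_mem hq))

/-- If `N` is divisible by every prime for which `G` has torsion, then powers of `N` annihilate
all torsion elements. -/
theorem exists_pow_nsmul_eq_zero {N : ℕ}
    (hN : ∀ p : ℕ, p.Prime → (∃ x : G, x ≠ 0 ∧ p • x = 0) → p ∣ N) {n : ℕ} (hn : n ≠ 0)
    {x : G} (hx : n • x = 0) : ∃ k : ℕ, N ^ k • x = 0 := by
  induction n using induction_on_primes generalizing x with
  | zero => exact absurd rfl hn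
  | one => exact ⟨0, by simpa using hx⟩
  | prime_mul p m hp ih =>
    obtain ⟨k, hk⟩ := ih (right_ne_zero_of_mul hn) (x := p • x) (by
      rw [← mul_smul, mul_comm, hx])
    have hpk : p • N ^ k • x = 0 := by rw [smul_comm, hk]
    by_cases h0 : N ^ k • x = 0
    · exact ⟨k, h0⟩
    · obtain ⟨c, hc⟩ := hN p hp ⟨_, h0, hpk⟩
      refine ⟨k + 1, ?_⟩
      have hNc : N = c * p := hc.trans (mul_comm p c)
      rw [pow_succ, mul_smul, hNc, mul_smul c p x, ← hNc, smul_comm, smul_comm _ p, hpk, smul_zero]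

end Int

/-- An abelian group `G` is artinian if and only if: `G` is torsion, the `p`-torsion
`{x ∈ G | p • x = 0}` is finite for every prime `p`, and `G` has non-trivial
`p`-torsion for only finitely many primes `p`. -/
theorem addArtinian_iff_torsion_conditions (G : Type*) [AddCommGroup G] :
    AddArtinian G ↔
      ((∀ x : G, ∃ n : ℕ, 0 < n ∧ n • x = 0) ∧
        (∀ p : ℕ, p.Prime → {x : G | p • x = 0}.Finite) ∧
        {p : ℕ | p.Prime ∧ ∃ x : G, x ≠ 0 ∧ p • x = 0}.Finite) := by
  constructor
  · intro h
    have : IsArtinian ℤ G := (addArtinian_iff_isArtinian_int G).1 h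
    exact ⟨IsArtinian.exists_pos_nsmul_eq_zero,
      fun p hp => IsArtinian.finite_setOf_prime_nsmul_eq_zero hp, h.finite_setOf_prime_torsion⟩
  · rintro ⟨htors, hfin, hprimes⟩
    rw [addArtinian_iff_isArtinian_int]
    let N : ℕ := ∏ p ∈ hprimes.toFinset, p
    have hN : {x : G | N • x = 0}.Finite := finite_setOf_prod_nsmul_eq_zero _ fun p hp =>
      hfin p (hprimes.mem_toFinset.1 hp).1
    have : Finite (Submodule.torsionBy ℤ G (N : ℤ)) :=
      (hN.subset fun x hx => by simpa using hx :
        ((Submodule.torsionBy ℤ G (N : ℤ) : Submodule ℤ G) : Set G).Finite).to_subtype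
    have : IsArtinian ℤ (Submodule.torsionBy ℤ G (N : ℤ)) := isArtinian_of_finite
    refine isArtinian_of_isArtinian_torsionBy (N : ℤ) fun x => ?_
    obtain ⟨n, hn, hx⟩ := htors x
    obtain ⟨k, hk⟩ := exists_pow_nsmul_eq_zero (N := N) (fun p hp h =>
      Finset.dvd_prod_of_mem _ (hprimes.mem_toFinset.2 ⟨hp, h⟩)) hn.ne' hx
    refine ⟨k, ?_⟩
    rw [← Nat.cast_pow, natCast_zsmul, hk]
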